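/- arXiv:1304.7602 — 3 statements merged into one kernel-verified Lean document; each statement's English description precedes it below -/
import Mathlib

section
/- Second reduction property of the Izergin determinant: let x̄, ȳ ∈ ℂⁿ and z ∈ ℂ, z ≠ 0, be such that the extended tuples (x₁,…,xₙ, z) and (y₁,…,yₙ, zq²) are admissible (entries of each tuple pairwise distinct and every entry of the first tuple distinct from every entry of the second). Then K_{n+1}((x̄, z)|(ȳ, zq²)) = −(1/(qz))·K_n(x̄|ȳ). -/
open Finset

/-- The function `f(u,v) = (qu - q⁻¹v)/(u - v)`. -/
noncomputable def fF (q u v : ℂ) : ℂ := (q * u - q⁻¹ * v) / (u - v)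

/-- The function `g(u,v) = (q - q⁻¹)/(u - v)`. -/
noncomputable def gF (q u v : ℂ) : ℂ := (q - q⁻¹) / (u - v)

/-- The Izergin determinant `K_n(x̄|ȳ)`. -/
noncomputable def Kiz (q : ℂ) {n : ℕ} (x y : Fin n → ℂ) : ℂ :=
  (∏ i : Fin n, ∏ j ∈ Finset.Ioi i, ((x i - x j) * (y j - y i)))⁻¹ *
    ∑ σ : Equiv.Perm (Fin n), ((Equiv.Perm.sign σ : ℤ) : ℂ) *
      ∏ i : Fin n,
        ((q - q⁻¹) / (x i - y (σ i)) *
          ∏ j ∈ Finset.univ.erase (σ i), (q * x i - q⁻¹ * y j))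

/-- The modified Izergin determinant `K^{(l)}_n(x̄|ȳ) = (∏ x_i)·K_n(x̄|ȳ)`. -/
noncomputable def Kl (q : ℂ) {n : ℕ} (x y : Fin n → ℂ) : ℂ := (∏ i, x i) * Kiz q x y

/-- The modified Izergin determinant `K^{(r)}_n(x̄|ȳ) = (∏ y_j)·K_n(x̄|ȳ)`. -/
noncomputable def Kr (q : ℂ) {n : ℕ} (x y : Fin n → ℂ) : ℂ := (∏ j, y j) * Kiz q x y

/-- The Izergin determinant as a matrix determinant. -/
lemma Kiz_eq_det (q : ℂ) {n : ℕ} (x y : Fin n → ℂ) :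
    Kiz q x y = (∏ i : Fin n, ∏ j ∈ Finset.Ioi i, ((x i - x j) * (y j - y i)))⁻¹ *
      (Matrix.of fun i k : Fin n => (q - q⁻¹) / (x i - y k) *
        ∏ j ∈ Finset.univ.erase k, (q * x i - q⁻¹ * y j)).det := by
  rw [Kiz, ← Matrix.det_transpose, Matrix.det_apply']
  rfl

lemma Fin.prod_Ioi_castSucc {M : Type*} [CommMonoid M] {n : ℕ} (i : Fin n)
    (f : Fin (n + 1) → M) :
    ∏ j ∈ Finset.Ioi i.castSucc, f j = (∏ j ∈ Finset.Ioi i, f j.castSucc) * f (Fin.last n) := by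
  rw [← Finset.filter_lt_eq_Ioi, ← Finset.filter_lt_eq_Ioi, Finset.prod_filter,
    Finset.prod_filter, Fin.prod_univ_castSucc]
  simp [Fin.castSucc_lt_last]

lemma Fin.prod_erase_castSucc {M : Type*} [CommMonoid M] {n : ℕ} (k : Fin n)
    (f : Fin (n + 1) → M) :
    ∏ j ∈ Finset.univ.erase k.castSucc, f j =
      (∏ j ∈ Finset.univ.erase k, f j.castSucc) * f (Fin.last n) := by
  rw [← Finset.filter_ne', ← Finset.filter_ne', Finset.prod_filter,
    Finset.prod_filter, Fin.prod_univ_castSucc]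
  simp [(Fin.castSucc_lt_last k).ne']

lemma Fin.prod_erase_last {M : Type*} [CommMonoid M] {n : ℕ} (f : Fin (n + 1) → M) :
    ∏ j ∈ Finset.univ.erase (Fin.last n), f j = ∏ j : Fin n, f j.castSucc := by
  rw [← Finset.filter_ne', Finset.prod_filter, Fin.prod_univ_castSucc]
  simp [fun k : Fin n => (Fin.castSucc_lt_last k).ne]

/-- Second reduction property: `K_{n+1}((x̄, z)|(ȳ, zq²)) = −(1/(qz))·K_n(x̄|ȳ)`. -/
theorem izergin_reduction_right (q : ℂ) (hq : q ≠ 0) (hq2 : q ^ 2 ≠ 1)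
    (n : ℕ) (x y : Fin n → ℂ) (z : ℂ) (hz : z ≠ 0)
    (hx : Function.Injective (Fin.snoc x z : Fin (n + 1) → ℂ))
    (hy : Function.Injective (Fin.snoc y (q ^ 2 * z) : Fin (n + 1) → ℂ))
    (hxy : ∀ i j, (Fin.snoc x z : Fin (n + 1) → ℂ) i
        ≠ (Fin.snoc y (q ^ 2 * z) : Fin (n + 1) → ℂ) j) :
    Kiz q (Fin.snoc x z) (Fin.snoc y (q ^ 2 * z)) = -(1 / (q * z)) * Kiz q x y := by
  have hxz : ∀ i, x i - z ≠ 0 := fun i h => by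
    have := hx (a₁ := i.castSucc) (a₂ := Fin.last n) (by simpa using sub_eq_zero.mp h)
    exact (Fin.castSucc_lt_last i).ne this
  have hyz : ∀ i, q ^ 2 * z - y i ≠ 0 := fun i h => by
    have := hy (a₁ := i.castSucc) (a₂ := Fin.last n) (by simpa using (sub_eq_zero.mp h).symm)
    exact (Fin.castSucc_lt_last i).ne this
  have hcancel : q * z - q⁻¹ * (q ^ 2 * z) = 0 := by field_simp; ring
  have hcorner : (q - q⁻¹) / (z - q ^ 2 * z) = -(1 / (q * z)) := by
    have h1 : 1 - q ^ 2 ≠ 0 := sub_ne_zero.mpr hq2.symm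
    have h2 : z - q ^ 2 * z ≠ 0 := by
      rw [show z - q ^ 2 * z = z * (1 - q ^ 2) by ring]
      exact mul_ne_zero hz h1
    field_simp
    ring
  have hfactor : ∀ i, (q * x i - q⁻¹ * (q ^ 2 * z)) * (q * z - q⁻¹ * y i) =
      (x i - z) * (q ^ 2 * z - y i) := fun i => by field_simp
  have hprod : (∏ i, (q * x i - q⁻¹ * (q ^ 2 * z))) * ∏ i, (q * z - q⁻¹ * y i) =
      ∏ i, ((x i - z) * (q ^ 2 * z - y i)) := by
    rw [← Finset.prod_mul_distrib]
    exact Finset.prod_congr rfl fun i _ => hfactor i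
  have hne : ∏ i, ((x i - z) * (q ^ 2 * z - y i)) ≠ 0 :=
    Finset.prod_ne_zero_iff.mpr fun i _ => mul_ne_zero (hxz i) (hyz i)
  rw [Kiz_eq_det, Kiz_eq_det, Matrix.det_succ_row _ (Fin.last n), Fin.sum_univ_castSucc,
    Finset.sum_eq_zero, zero_add]
  · have hminor : (Matrix.of fun i k : Fin (n + 1) =>
        (q - q⁻¹) / ((Fin.snoc x z : Fin (n + 1) → ℂ) i -
            (Fin.snoc y (q ^ 2 * z) : Fin (n + 1) → ℂ) k) *
          ∏ j ∈ Finset.univ.erase k, (q * (Fin.snoc x z : Fin (n + 1) → ℂ) i -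
            q⁻¹ * (Fin.snoc y (q ^ 2 * z) : Fin (n + 1) → ℂ) j)).submatrix
          (Fin.last n).succAbove (Fin.last n).succAbove =
        Matrix.of fun i k => (q * x i - q⁻¹ * (q ^ 2 * z)) *
          (Matrix.of fun i k : Fin n => (q - q⁻¹) / (x i - y k) *
            ∏ j ∈ Finset.univ.erase k, (q * x i - q⁻¹ * y j)) i k := by
      ext i k
      simp only [Matrix.submatrix_apply, Matrix.of_apply, Fin.succAbove_last,
        Fin.prod_erase_castSucc, Fin.snoc_castSucc, Fin.snoc_last]
      ring
    rw [hminor, Matrix.det_mul_column, Fin.prod_univ_castSucc]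
    simp only [Matrix.of_apply, Fin.prod_Ioi_castSucc, Fin.prod_erase_last, Fin.snoc_castSucc,
      Fin.snoc_last, hcorner, Finset.prod_mul_distrib (s := (Finset.univ : Finset (Fin n)))]
    rw [← Finset.prod_mul_distrib (f := fun i => x i - z), ← hprod]
    rw [← hprod] at hne
    rw [← two_mul, pow_mul]
    have hlast : Finset.Ioi (Fin.last n) = ∅ := by ext; simp [Fin.le_last]
    rw [hlast]
    obtain ⟨h1, h2⟩ := mul_ne_zero_iff.mp hne
    simp only [neg_one_sq, one_pow, Finset.prod_empty, mul_one, one_mul, mul_inv_rev]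
    generalize (∏ i, (q * x i - q⁻¹ * (q ^ 2 * z))) = a at h1 ⊢
    generalize (∏ i, (q * z - q⁻¹ * y i)) = b at h2 ⊢
    generalize Matrix.det (R := ℂ) (n := Fin n) _ = d
    generalize (∏ i, ∏ j ∈ Finset.Ioi i, ((x i - x j) * (y j - y i)))⁻¹ = e
    field_simp
  · intro k _
    rw [Matrix.of_apply, Fin.prod_erase_castSucc]
    simp only [Fin.snoc_last, hcancel]
    simp
end

section
/- Inverse order of arguments for the modified Izergin determinants: let x̄, ȳ ∈ ℂⁿ be admissible tuples (x_i pairwise distinct, y_j pairwise distinct, x_i ≠ y_j for all i,j). (a) If moreover q⁻²x_i ≠ y_j for all i,j, then f(ȳ,x̄)·K^{(r)}_n(q⁻²x̄|ȳ) = (−q)ⁿ·K^{(l)}_n(ȳ|x̄). (b) If moreover x_i ≠ q²y_j for all i,j, then f(ȳ,x̄)·K^{(l)}_n(x̄|q²ȳ) = (−q)^{−n}·K^{(r)}_n(ȳ|x̄). Here q⁻²x̄ = (q⁻²x₁,…,q⁻²xₙ), q²ȳ = (q²y₁,…,q²yₙ), and f(ȳ,x̄) = ∏_{j,i} f(y_j,x_i).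 -/
open Finset

/-- A product of `c ^ 2` over the pairs `i < j` in `Fin n` is `c` to the power `(n - 1) * n`. -/
theorem prod_prod_Ioi_sq (n : ℕ) (c : ℂ) :
    ∏ i : Fin n, ∏ _j ∈ Finset.Ioi i, c ^ 2 = (c ^ (n - 1)) ^ n := by
  have h : (∑ i : Fin n, (n - 1 - (i : ℕ))) * 2 = n * (n - 1) := by
    rw [Fin.sum_univ_eq_sum_range (fun i => n - 1 - i) n,
      Finset.sum_range_reflect (fun i => i) n, Finset.sum_range_id_mul_two]
  simp only [Finset.prod_const, Fin.card_Ioi]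
  rw [Finset.prod_pow_eq_pow_sum, ← pow_mul, ← pow_mul, mul_comm 2, h, mul_comm]

/-- The Izergin determinant is homogeneous of degree `-n`. -/
theorem Kiz_smul (q c : ℂ) (hc : c ≠ 0) {n : ℕ} (x y : Fin n → ℂ) :
    Kiz q (fun i => c * x i) (fun j => c * y j) = (c ^ n)⁻¹ * Kiz q x y := by
  have hD : ∏ i : Fin n, ∏ j ∈ Finset.Ioi i, ((c * x i - c * x j) * (c * y j - c * y i))
      = (c ^ (n - 1)) ^ n * ∏ i : Fin n, ∏ j ∈ Finset.Ioi i, ((x i - x j) * (y j - y i)) := by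
    rw [← prod_prod_Ioi_sq, ← Finset.prod_mul_distrib]
    refine Finset.prod_congr rfl fun i _ => ?_
    rw [← Finset.prod_mul_distrib]
    exact Finset.prod_congr rfl fun j _ => by ring
  have hT (σ : Equiv.Perm (Fin n)) :
      ∏ i, ((q - q⁻¹) / (c * x i - c * y (σ i)) *
        ∏ j ∈ Finset.univ.erase (σ i), (q * (c * x i) - q⁻¹ * (c * y j)))
      = (c ^ n)⁻¹ * (c ^ (n - 1)) ^ n * ∏ i, ((q - q⁻¹) / (x i - y (σ i)) *
        ∏ j ∈ Finset.univ.erase (σ i), (q * x i - q⁻¹ * y j)) := by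
    have hi (i : Fin n) : (q - q⁻¹) / (c * x i - c * y (σ i)) *
        ∏ j ∈ Finset.univ.erase (σ i), (q * (c * x i) - q⁻¹ * (c * y j))
        = (c⁻¹ * c ^ (n - 1)) * ((q - q⁻¹) / (x i - y (σ i)) *
          ∏ j ∈ Finset.univ.erase (σ i), (q * x i - q⁻¹ * y j)) := by
      have hj : ∏ j ∈ Finset.univ.erase (σ i), (q * (c * x i) - q⁻¹ * (c * y j))
          = c ^ (n - 1) * ∏ j ∈ Finset.univ.erase (σ i), (q * x i - q⁻¹ * y j) := by
        rw [Finset.prod_congr rfl fun j _ =>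
          show q * (c * x i) - q⁻¹ * (c * y j) = c * (q * x i - q⁻¹ * y j) by ring]
        simp [Finset.prod_mul_distrib, Finset.card_erase_of_mem]
      rw [hj, ← mul_sub, div_mul_eq_div_div, div_eq_mul_inv _ c, div_mul_eq_mul_div]
      ring
    rw [Finset.prod_congr rfl fun i _ => hi i, Finset.prod_mul_distrib]
    simp [mul_pow]
  have hcn : (c ^ (n - 1)) ^ n ≠ 0 := pow_ne_zero _ (pow_ne_zero _ hc)
  simp only [Kiz, hD, hT]
  simp only [mul_left_comm (((Equiv.Perm.sign _ : ℤ) : ℂ)), ← Finset.mul_sum]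
  rw [mul_inv]
  field_simp

/-- Inverse order of arguments for the unmodified Izergin determinant. -/
theorem prod_fF_mul_Kiz (q : ℂ) (hq : q ≠ 0) {n : ℕ} (x y : Fin n → ℂ)
    (hxy : ∀ i j, x i ≠ y j) (h : ∀ i j, (q ^ 2)⁻¹ * x i ≠ y j) :
    (∏ j, ∏ i, fF q (y j) (x i)) * Kiz q (fun i => (q ^ 2)⁻¹ * x i) y
      = (-q) ^ n * Kiz q y x := by
  have hD : ∏ i : Fin n, ∏ j ∈ Finset.Ioi i,
        (((q ^ 2)⁻¹ * x i - (q ^ 2)⁻¹ * x j) * (y j - y i))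
      = ((-q⁻¹) ^ (n - 1)) ^ n *
        ∏ i : Fin n, ∏ j ∈ Finset.Ioi i, ((y i - y j) * (x j - x i)) := by
    rw [← prod_prod_Ioi_sq, ← Finset.prod_mul_distrib]
    refine Finset.prod_congr rfl fun i _ => ?_
    rw [← Finset.prod_mul_distrib]
    exact Finset.prod_congr rfl fun j _ => by ring
  have hT (σ : Equiv.Perm (Fin n)) :
      (∏ j, ∏ i, fF q (y j) (x i)) * ∏ i, ((q - q⁻¹) / ((q ^ 2)⁻¹ * x i - y (σ i)) *
        ∏ j ∈ Finset.univ.erase (σ i), (q * ((q ^ 2)⁻¹ * x i) - q⁻¹ * y j))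
      = (-q) ^ n * ((-q⁻¹) ^ (n - 1)) ^ n * ∏ j, ((q - q⁻¹) / (y j - x (σ⁻¹ j)) *
        ∏ i ∈ Finset.univ.erase (σ⁻¹ j), (q * y j - q⁻¹ * x i)) := by
    have hi (i : Fin n) : (∏ j, fF q (y j) (x i)) *
        ((q - q⁻¹) / ((q ^ 2)⁻¹ * x i - y (σ i)) *
          ∏ j ∈ Finset.univ.erase (σ i), (q * ((q ^ 2)⁻¹ * x i) - q⁻¹ * y j))
        = (-q * (-q⁻¹) ^ (n - 1)) * ((q - q⁻¹) / (y (σ i) - x i) *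
          ∏ j ∈ Finset.univ.erase (σ i), (q * y j - q⁻¹ * x i)) := by
      have hd : fF q (y (σ i)) (x i) * ((q - q⁻¹) / ((q ^ 2)⁻¹ * x i - y (σ i)))
          = -q * ((q - q⁻¹) / (y (σ i) - x i)) := by
        have h1 : y (σ i) - x i ≠ 0 := sub_ne_zero.2 (hxy i (σ i)).symm
        have h2 : (q ^ 2)⁻¹ * x i - y (σ i) ≠ 0 := sub_ne_zero.2 (h i (σ i))
        have h3 : q * y (σ i) - q⁻¹ * x i = -q * ((q ^ 2)⁻¹ * x i - y (σ i)) := by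
          field_simp
          ring
        rw [fF, h3, div_mul_div_comm, mul_div_assoc', div_eq_div_iff (mul_ne_zero h1 h2) h1]
        ring
      have he : (∏ j ∈ Finset.univ.erase (σ i), fF q (y j) (x i)) *
          ∏ j ∈ Finset.univ.erase (σ i), (q * ((q ^ 2)⁻¹ * x i) - q⁻¹ * y j)
          = (-q⁻¹) ^ (n - 1) *
            ∏ j ∈ Finset.univ.erase (σ i), (q * y j - q⁻¹ * x i) := by
        have hc : (-q⁻¹) ^ (n - 1) = ∏ _j ∈ Finset.univ.erase (σ i), (-q⁻¹) := by
          simp [Finset.card_erase_of_mem]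
        rw [hc, ← Finset.prod_mul_distrib, ← Finset.prod_mul_distrib]
        refine Finset.prod_congr rfl fun j _ => ?_
        have h1 : y j - x i ≠ 0 := sub_ne_zero.2 (hxy i j).symm
        have h2 : q * ((q ^ 2)⁻¹ * x i) - q⁻¹ * y j = -q⁻¹ * (y j - x i) := by
          field_simp
          ring
        rw [fF, h2, mul_left_comm, div_mul_cancel₀ _ h1]
      rw [← Finset.mul_prod_erase Finset.univ _ (Finset.mem_univ (σ i)),
        mul_mul_mul_comm, hd, he]
      ring
    have hp : ∏ i, ∏ j ∈ Finset.univ.erase (σ i), (q * y j - q⁻¹ * x i)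
        = ∏ j, ∏ i ∈ Finset.univ.erase (σ⁻¹ j), (q * y j - q⁻¹ * x i) := by
      refine Finset.prod_comm' fun i j => ?_
      simpa using not_congr (eq_comm.trans (Equiv.eq_symm_apply σ).symm)
    have hr : ∏ i, (q - q⁻¹) / (y (σ i) - x i) = ∏ j, (q - q⁻¹) / (y j - x (σ⁻¹ j)) := by
      rw [← Equiv.prod_comp σ fun j => (q - q⁻¹) / (y j - x (σ⁻¹ j))]
      simp
    rw [Finset.prod_comm, ← Finset.prod_mul_distrib, Finset.prod_congr rfl fun i _ => hi i,
      Finset.prod_mul_distrib,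
      Finset.prod_mul_distrib (f := fun i => (q - q⁻¹) / _), hp, hr,
      ← Finset.prod_mul_distrib,
      Finset.prod_const, Finset.card_univ, Fintype.card_fin, mul_pow]
  have hcn : ((-q⁻¹) ^ (n - 1)) ^ n ≠ 0 :=
    pow_ne_zero _ (pow_ne_zero _ (neg_ne_zero.2 (inv_ne_zero hq)))
  simp only [Kiz, hD]
  rw [mul_left_comm, Finset.mul_sum]
  simp only [mul_left_comm _ (((Equiv.Perm.sign _ : ℤ) : ℂ)), hT]
  rw [← Equiv.sum_comp (Equiv.inv (Equiv.Perm (Fin n))) fun σ =>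
    ((Equiv.Perm.sign σ : ℤ) : ℂ) * ∏ j, ((q - q⁻¹) / (y j - x (σ j)) *
      ∏ i ∈ Finset.univ.erase (σ j), (q * y j - q⁻¹ * x i))]
  simp only [Equiv.inv_apply, Equiv.Perm.sign_inv,
    mul_left_comm (((Equiv.Perm.sign _ : ℤ) : ℂ)), ← Finset.mul_sum]
  generalize ((-q⁻¹) ^ (n - 1)) ^ n = a at hcn ⊢
  rw [mul_inv]
  field_simp

/-- Inverse order of arguments for the modified Izergin determinants:
(a) `f(ȳ,x̄)·K^{(r)}_n(q⁻²x̄|ȳ) = (−q)ⁿ·K^{(l)}_n(ȳ|x̄)` and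
(b) `f(ȳ,x̄)·K^{(l)}_n(x̄|q²ȳ) = (−q)^{−n}·K^{(r)}_n(ȳ|x̄)`. -/
theorem izergin_modified_inverse_order (q : ℂ) (hq : q ≠ 0) (hq2 : q ^ 2 ≠ 1)
    (n : ℕ) (x y : Fin n → ℂ)
    (hx : Function.Injective x) (hy : Function.Injective y)
    (hxy : ∀ i j, x i ≠ y j) :
    ((∀ i j, (q ^ 2)⁻¹ * x i ≠ y j) →
      (∏ j, ∏ i, fF q (y j) (x i)) * Kr q (fun i => (q ^ 2)⁻¹ * x i) y
        = (-q) ^ n * Kl q y x) ∧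
    ((∀ i j, x i ≠ q ^ 2 * y j) →
      (∏ j, ∏ i, fF q (y j) (x i)) * Kl q x (fun j => q ^ 2 * y j)
        = (-q) ^ (-(n : ℤ)) * Kr q y x) := by
  have hqq : q ^ 2 ≠ 0 := pow_ne_zero 2 hq
  refine ⟨fun h => ?_, fun h => ?_⟩
  · rw [Kr, Kl, mul_left_comm, prod_fF_mul_Kiz q hq x y hxy h, mul_left_comm]
  · have h' (i j : Fin n) : (q ^ 2)⁻¹ * x i ≠ y j := fun e => h i j (by
      rw [← e, mul_inv_cancel_left₀ hqq])
    have hs := Kiz_smul q (q ^ 2) hqq (fun i => (q ^ 2)⁻¹ * x i) y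
    simp only [mul_inv_cancel_left₀ hqq] at hs
    have hn : ((q ^ 2) ^ n)⁻¹ * (-q) ^ n = (-q) ^ (-(n : ℤ)) := by
      rw [zpow_neg, zpow_natCast, ← neg_sq q, ← pow_mul, mul_comm 2 n, pow_mul]
      field_simp
    rw [Kr, Kl, hs, ← hn, mul_left_comm, mul_left_comm (∏ j, ∏ i, fF q (y j) (x i)),
      prod_fF_mul_Kiz q hq x y hxy h']
    ring
end

section
/- Summation formula for the Izergin determinant (main lemma, first form): let m₁, m₂ ≥ 0 and let ᾱ ∈ ℂ^{m₁}, β̄ ∈ ℂ^{m₂}, γ̄ ∈ ℂ^{m₁+m₂} be tuples such that: the entries of ᾱ are pairwise distinct, the entries of β̄ are pairwise distinct, the entries of γ̄ are pairwise distinct, α_i ≠ γ_k and β_j ≠ γ_k for all indices, q⁻²α_i ≠ β_j for all i,j, and q⁻²α_i ≠ γ_k for all i,k. Then ∑_{I} K_{m₁}(γ̄_I | ᾱ)·K_{m₂}(β̄ | γ̄_{II})·f(γ̄_{II}, γ̄_I) = (−q)^{−m₁}·f(γ̄, ᾱ)·K_{m₁+m₂}((q⁻²ᾱ, β̄) | γ̄),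 where the sum is over all subsets I ⊆ {1,…,m₁+m₂} of size m₁, γ̄_I and γ̄_{II} denote the subtuples of γ̄ indexed by I and its complement (in increasing index order), f(γ̄_{II},γ̄_I) = ∏_{k∈II}∏_{l∈I} f(γ_k,γ_l), f(γ̄,ᾱ) = ∏_{k}∏_{i} f(γ_k,α_i), and (q⁻²ᾱ, β̄) denotes the concatenated tuple (q⁻²α₁,…,q⁻²α_{m₁}, β₁,…,β_{m₂}). -/
open Finset

/-- The subtuple of `γ` indexed by a finset `I` of cardinality `m`, in increasing
index order. -/
noncomputable def sub {N m : ℕ} (γ : Fin N → ℂ) (I : Finset (Fin N)) (h : I.card = m) :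
    Fin m → ℂ :=
  fun k => γ (I.orderIsoOfFin h k : Fin N)

lemma card_compl_of_mem_powersetCard {m₁ m₂ : ℕ}
    (I : {I : Finset (Fin (m₁ + m₂)) // I ∈ Finset.powersetCard m₁ Finset.univ}) :
    I.1ᶜ.card = m₂ := by
  have h := (Finset.mem_powersetCard.mp I.2).2
  rw [Finset.card_compl, h, Fintype.card_fin]
  omega

open Polynomial in
/-- A polynomial of degree at most `2n` vanishing at `n` points is determined by its values at
`n + 1` further points. -/
lemma sum_mul_prod_succAbove_eq {n : ℕ} (a b : ℂ) {y : Fin (n + 1) → ℂ} {x : Fin n → ℂ}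
    (hy : Function.Injective y) (hx : Function.Injective x) (hxy : ∀ i k, x i ≠ y k)
    (d : Fin (n + 1) → ℂ)
    (h : ∀ i, ∑ k, d k * ∏ j : Fin n,
      ((x i - y (k.succAbove j)) * (a * x i - b * y (k.succAbove j))) = 0) (z : ℂ) :
    ∑ k, d k * ∏ j : Fin n, ((z - y (k.succAbove j)) * (a * z - b * y (k.succAbove j))) =
      (∏ i, (z - x i)) * ∑ k, d k * (∏ j : Fin n, (a * y k - b * y (k.succAbove j))) /
        (∏ i, (y k - x i)) * ∏ j : Fin n, (z - y (k.succAbove j)) := by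
  let P : ℂ[X] := ∑ k, C (d k) * ∏ j : Fin n,
    ((X - C (y (k.succAbove j))) * (C a * X - C (b * y (k.succAbove j))))
  let Q : ℂ[X] := (∏ i, (X - C (x i))) *
    ∑ k, C (d k * (∏ j : Fin n, (a * y k - b * y (k.succAbove j))) / (∏ i, (y k - x i))) *
      ∏ j : Fin n, (X - C (y (k.succAbove j)))
  have hP (w : ℂ) : P.eval w = ∑ k, d k * ∏ j : Fin n,
      ((w - y (k.succAbove j)) * (a * w - b * y (k.succAbove j))) := by
    simp [P, eval_finsetSum, eval_prod]
  have hQ (w : ℂ) : Q.eval w = (∏ i, (w - x i)) *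
      ∑ k, d k * (∏ j : Fin n, (a * y k - b * y (k.succAbove j))) /
        (∏ i, (y k - x i)) * ∏ j : Fin n, (w - y (k.succAbove j)) := by
    simp [Q, eval_finsetSum, eval_prod]
  have hprod {u : Fin n → ℂ[X]} {c : ℕ} (hu : ∀ i, (u i).natDegree ≤ c) :
      (∏ i, u i).natDegree ≤ n * c :=
    (natDegree_prod_le _ _).trans ((Finset.sum_le_card_nsmul _ _ c fun i _ => hu i).trans (by simp))
  have hlt {R : ℂ[X]} (hR : R.natDegree ≤ 2 * n) :
      R.degree < #(univ : Finset (Fin (n + 1) ⊕ Fin n)) := by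
    refine degree_le_natDegree.trans_lt ?_
    rw [card_univ, Fintype.card_sum, Fintype.card_fin, Fintype.card_fin]
    exact_mod_cast (by omega : R.natDegree < n + 1 + n)
  have hPdeg : P.natDegree ≤ 2 * n := by
    refine natDegree_sum_le_of_forall_le _ _ fun k _ => (natDegree_C_mul_le _ _).trans ?_
    refine (hprod (c := 2) fun j => ?_).trans (by omega)
    compute_degree
  have hQdeg : Q.natDegree ≤ 2 * n := by
    refine natDegree_mul_le.trans ((add_le_add (hprod (c := 1) fun i => ?_)
      (natDegree_sum_le_of_forall_le _ _ (n := n * 1) fun k _ =>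
        (natDegree_C_mul_le _ _).trans (hprod fun j => ?_))).trans (by omega))
    · compute_degree
    · compute_degree
  have hz (k l : Fin (n + 1)) (hkl : l ≠ k) : ∃ j : Fin n, l.succAbove j = k :=
    Fin.exists_succAbove_eq hkl.symm
  have hPQ : P = Q := by
    refine Polynomial.eq_of_degrees_lt_of_eval_index_eq (v := Sum.elim y x) univ ?_
      (hlt hPdeg) (hlt hQdeg) ?_
    · exact ((hy.sumElim hx fun k i => (hxy i k).symm)).injOn
    · rintro (k | i) -
      · rw [hP, hQ, Sum.elim_inl, Finset.sum_eq_single k, Finset.sum_eq_single k]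
        · have : ∏ i, (y k - x i) ≠ 0 :=
            Finset.prod_ne_zero_iff.2 fun i _ => sub_ne_zero.2 (hxy i k).symm
          rw [Finset.prod_mul_distrib]
          field_simp
        · intro l _ hl
          obtain ⟨j, hj⟩ := hz k l hl
          rw [Finset.prod_eq_zero (f := fun j => y k - y (l.succAbove j)) (mem_univ j)
            (by rw [hj, sub_self]), mul_zero]
        · simp
        · intro l _ hl
          obtain ⟨j, hj⟩ := hz k l hl
          rw [Finset.prod_eq_zero (mem_univ j) (by rw [hj, sub_self, zero_mul]), mul_zero]
        · simp
      · rw [hP, hQ, Sum.elim_inr, h, Finset.prod_eq_zero (mem_univ i) (sub_self _), zero_mul]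
  rw [← hP, ← hQ, hPQ]

/-- The matrix whose determinant is the numerator of the Izergin determinant. -/
noncomputable def izerginMatrix (q : ℂ) {n : ℕ} (x y : Fin n → ℂ) : Matrix (Fin n) (Fin n) ℂ :=
  Matrix.of fun i j =>
    (q - q⁻¹) / (x i - y j) * ∏ k ∈ univ.erase j, (q * x i - q⁻¹ * y k)

lemma Kiz_eq_det_s10 (q : ℂ) {n : ℕ} (x y : Fin n → ℂ) :
    Kiz q x y = ((Matrix.vandermonde (-x)).det * (Matrix.vandermonde y).det)⁻¹ *
      (izerginMatrix q x y).det := by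
  rw [Matrix.det_vandermonde, Matrix.det_vandermonde, ← Finset.prod_mul_distrib,
    ← Matrix.det_transpose (izerginMatrix q x y), Matrix.det_apply']
  simp_rw [← Finset.prod_mul_distrib]
  simp [Kiz, izerginMatrix, sub_eq_add_neg, add_comm]

lemma det_vandermonde_comp_perm {n : ℕ} (x : Fin n → ℂ) (σ : Equiv.Perm (Fin n)) :
    (Matrix.vandermonde (x ∘ σ)).det = Equiv.Perm.sign σ * (Matrix.vandermonde x).det := by
  rw [← Matrix.det_permute]
  rfl

lemma sign_mul_sign {n : ℕ} (σ : Equiv.Perm (Fin n)) :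
    ((Equiv.Perm.sign σ : ℤ) : ℂ) * ((Equiv.Perm.sign σ : ℤ) : ℂ) = 1 := by
  rw [← Int.cast_mul, ← Units.val_mul, Int.units_mul_self]
  simp

lemma Kiz_comp_perm_left (q : ℂ) {n : ℕ} (x y : Fin n → ℂ) (σ : Equiv.Perm (Fin n)) :
    Kiz q (x ∘ σ) y = Kiz q x y := by
  have h1 : -(x ∘ σ) = (-x) ∘ σ := rfl
  have h2 : (izerginMatrix q (x ∘ σ) y).det =
      Equiv.Perm.sign σ * (izerginMatrix q x y).det := by
    rw [← Matrix.det_permute]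
    rfl
  have h3 := sign_mul_sign σ
  have h4 : ((Equiv.Perm.sign σ : ℤ) : ℂ) ≠ 0 := left_ne_zero_of_mul_eq_one h3
  rw [Kiz_eq_det_s10, Kiz_eq_det_s10, h1, h2, det_vandermonde_comp_perm, mul_assoc, mul_inv _ (_ * _)]
  field_simp

/-- A point removed from a tuple splits off its factors of the Vandermonde determinant. -/
lemma det_vandermonde_succAbove {n : ℕ} (y : Fin (n + 1) → ℂ) (k : Fin (n + 1)) :
    (-1) ^ (k : ℕ) * (Matrix.vandermonde y).det =
      (∏ j : Fin n, (y (k.succAbove j) - y k)) *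
        (Matrix.vandermonde (y ∘ k.succAbove)).det := by
  have h := det_vandermonde_comp_perm y k.cycleRange.symm
  rw [Equiv.Perm.sign_symm, Fin.sign_cycleRange] at h
  push_cast at h
  rw [← h, Matrix.det_vandermonde, Matrix.det_vandermonde, Fin.prod_univ_succ, Fin.prod_Ioi_zero]
  simp [Fin.prod_Ioi_succ]

lemma prod_erase_eq_prod_succAbove {n : ℕ} (k : Fin (n + 1)) (u : Fin (n + 1) → ℂ) :
    ∏ j ∈ univ.erase k, u j = ∏ j : Fin n, u (k.succAbove j) := by
  rw [← Finset.compl_singleton, ← Fin.image_succAbove_univ,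
    Finset.prod_image (Fin.succAbove_right_injective.injOn)]

lemma det_izerginMatrix_submatrix (q : ℂ) {n : ℕ} (x y : Fin (n + 1) → ℂ) (k : Fin (n + 1)) :
    ((izerginMatrix q x y).submatrix Fin.succ k.succAbove).det =
      (∏ i : Fin n, (q * x i.succ - q⁻¹ * y k)) *
        (izerginMatrix q (x ∘ Fin.succ) (y ∘ k.succAbove)).det := by
  rw [← Matrix.det_mul_column]
  congr 1
  ext i j
  have hk : k ∈ univ.erase (k.succAbove j) := by simp [(Fin.succAbove_ne k j).symm]
  have hi : (univ.erase (k.succAbove j)).erase k = (univ.erase j).image k.succAbove := by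
    rw [Finset.erase_right_comm, ← Finset.compl_singleton, ← Fin.image_succAbove_univ,
      Finset.image_erase Fin.succAbove_right_injective]
  simp only [izerginMatrix, Matrix.submatrix_apply, Matrix.of_apply, Function.comp_apply]
  rw [← Finset.mul_prod_erase _ _ hk, hi, Finset.prod_image (Fin.succAbove_right_injective.injOn)]
  ring

lemma det_izerginMatrix_succ (q : ℂ) (hq : q - q⁻¹ ≠ 0) {n : ℕ} {x y : Fin (n + 1) → ℂ}
    (hx : Function.Injective x) (hy : Function.Injective y) (hxy : ∀ i k, x i ≠ y k) :
    (izerginMatrix q x y).det = (∏ i : Fin n, (x 0 - x i.succ)) *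
      ∑ k : Fin (n + 1), (-1) ^ (k : ℕ) * gF q (x 0) (y k) *
        (∏ j : Fin n, (q * y k - q⁻¹ * y (k.succAbove j))) *
        (∏ i : Fin n, ((q * x i.succ - q⁻¹ * y k) / (y k - x i.succ))) *
        (izerginMatrix q (x ∘ Fin.succ) (y ∘ k.succAbove)).det := by
  set M := izerginMatrix q x y with hM
  let r (z : ℂ) (k : Fin (n + 1)) : ℂ :=
    ∏ j : Fin n, ((z - y (k.succAbove j)) * (q * z - q⁻¹ * y (k.succAbove j)))
  let d (k : Fin (n + 1)) : ℂ := (-1) ^ (k : ℕ) * (M.submatrix Fin.succ k.succAbove).det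
  have hrow (i : Fin (n + 1)) : M i = ((q - q⁻¹) / ∏ j, (x i - y j)) • r (x i) := by
    ext k
    have h0 : x i - y k ≠ 0 := sub_ne_zero.2 (hxy i k)
    have h1 : ∏ j : Fin n, (x i - y (k.succAbove j)) ≠ 0 :=
      Finset.prod_ne_zero_iff.2 fun j _ => sub_ne_zero.2 (hxy i _)
    simp only [hM, izerginMatrix, Matrix.of_apply, Pi.smul_apply, smul_eq_mul, r,
      Finset.prod_mul_distrib, prod_erase_eq_prod_succAbove, Fin.prod_univ_succAbove _ k]
    field_simp
  have hdet (z : ℂ) : (M.updateRow 0 (r z)).det = ∑ k, d k * r z k := by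
    rw [Matrix.det_succ_row_zero]
    refine Finset.sum_congr rfl fun k _ => ?_
    have : (M.updateRow 0 (r z)).submatrix Fin.succ k.succAbove =
        M.submatrix Fin.succ k.succAbove := by
      ext i j
      simp
    rw [this, Matrix.updateRow_self]
    ring
  have hvanish (i : Fin n) : ∑ k, d k * r (x i.succ) k = 0 := by
    have h0 := Matrix.det_updateRow_eq_zero (M := M) (Fin.succ_ne_zero i)
    rw [hrow, Matrix.det_updateRow_smul, hdet] at h0
    exact (mul_eq_zero.1 h0).resolve_left (div_ne_zero hq
      (Finset.prod_ne_zero_iff.2 fun j _ => sub_ne_zero.2 (hxy _ j)))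
  have key := sum_mul_prod_succAbove_eq q q⁻¹ hy (hx.comp (Fin.succ_injective n))
    (fun i k => hxy i.succ k) d hvanish (x 0)
  have hM0 : M.det = ((q - q⁻¹) / ∏ j, (x 0 - y j)) * ∑ k, d k * r (x 0) k := by
    rw [← hdet, ← Matrix.det_updateRow_smul, ← hrow, Matrix.updateRow_eq_self]
  rw [hM0, key, mul_left_comm, Finset.mul_sum]
  congr 1
  refine Finset.sum_congr rfl fun k _ => ?_
  have h0 : x 0 - y k ≠ 0 := sub_ne_zero.2 (hxy 0 k)
  have h1 : ∏ j : Fin n, (x 0 - y (k.succAbove j)) ≠ 0 :=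
    Finset.prod_ne_zero_iff.2 fun j _ => sub_ne_zero.2 (hxy 0 _)
  simp only [d, det_izerginMatrix_submatrix, gF, Fin.prod_univ_succAbove _ k,
    Finset.prod_div_distrib, Function.comp_apply, hM]
  field_simp

lemma Kiz_succ (q : ℂ) (hq : q - q⁻¹ ≠ 0) {n : ℕ} {x y : Fin (n + 1) → ℂ}
    (hx : Function.Injective x) (hy : Function.Injective y) (hxy : ∀ i k, x i ≠ y k) :
    Kiz q x y = ∑ k, gF q (x 0) (y k) * (∏ j : Fin n, fF q (y k) (y (k.succAbove j))) *
      (∏ i : Fin n, fF q (x i.succ) (y k)) * Kiz q (x ∘ Fin.succ) (y ∘ k.succAbove) := by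
  have hxV := det_vandermonde_succAbove (-x) 0
  simp only [Fin.val_zero, pow_zero, one_mul, Fin.succAbove_zero, Pi.neg_apply] at hxV
  have hx0 : ∏ i : Fin n, (x 0 - x i.succ) ≠ 0 :=
    Finset.prod_ne_zero_iff.2 fun i _ => sub_ne_zero.2 (hx.ne (Fin.succ_ne_zero i).symm)
  rw [Kiz_eq_det_s10, det_izerginMatrix_succ q hq hx hy hxy, hxV, Finset.mul_sum, Finset.mul_sum]
  refine Finset.sum_congr rfl fun k _ => ?_
  have hyV := det_vandermonde_succAbove y k
  have e1 : ∏ j : Fin n, (y (k.succAbove j) - y k) =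
      (-1) ^ n * ∏ j : Fin n, (y k - y (k.succAbove j)) := by
    simpa using (Finset.prod_neg (s := univ) (f := fun j : Fin n => y k - y (k.succAbove j)))
  have e2 : ∏ i : Fin n, (y k - x i.succ) = (-1) ^ n * ∏ i : Fin n, (x i.succ - y k) := by
    simpa using (Finset.prod_neg (s := univ) (f := fun i : Fin n => x i.succ - y k))
  have e3 : ∏ i : Fin n, (-x i.succ - -x 0) = ∏ i : Fin n, (x 0 - x i.succ) :=
    Finset.prod_congr rfl fun i _ => by ring
  have e4 : (Matrix.vandermonde y).det = (-1 : ℂ) ^ (k : ℕ) * ((-1) ^ n *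
      (∏ j : Fin n, (y k - y (k.succAbove j))) *
        (Matrix.vandermonde (y ∘ k.succAbove)).det) := by
    rw [← e1, ← hyV, ← mul_assoc, ← mul_pow]
    simp
  have e5 : -(x ∘ Fin.succ) = (-x) ∘ Fin.succ := rfl
  have e6 : ((-1 : ℂ) ^ n) ^ 2 = 1 := by rw [← pow_mul, mul_comm, pow_mul]; simp
  rw [Kiz_eq_det_s10, e5, e3, e4]
  simp only [fF, Finset.prod_div_distrib, e2]
  field_simp
  rw [e6, one_mul]

lemma Kiz_succAbove (q : ℂ) (hq : q - q⁻¹ ≠ 0) {n : ℕ} {x y : Fin (n + 1) → ℂ}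
    (hx : Function.Injective x) (hy : Function.Injective y) (hxy : ∀ i k, x i ≠ y k)
    (r : Fin (n + 1)) :
    Kiz q x y = ∑ k, gF q (x r) (y k) * (∏ j : Fin n, fF q (y k) (y (k.succAbove j))) *
      (∏ i : Fin n, fF q (x (r.succAbove i)) (y k)) *
      Kiz q (x ∘ r.succAbove) (y ∘ k.succAbove) := by
  have hcomp : (x ∘ r.cycleRange.symm) ∘ Fin.succ = x ∘ r.succAbove := by
    ext i
    simp
  rw [← Kiz_comp_perm_left q x y r.cycleRange.symm,
    Kiz_succ q hq (hx.comp (Equiv.injective _)) hy fun i k => hxy _ k, hcomp]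
  simp

lemma det_vandermonde_smul {n : ℕ} (c : ℂ) (x : Fin n → ℂ) :
    (Matrix.vandermonde fun i => c * x i).det =
      (∏ j : Fin n, c ^ (j : ℕ)) * (Matrix.vandermonde x).det := by
  rw [← Matrix.det_mul_row]
  congr 1
  ext i j
  simp [Matrix.vandermonde_apply, mul_pow]

lemma pow_mul_prod_inv_sq_pow {q : ℂ} (hq : q ≠ 0) (n : ℕ) :
    q ^ (n * n) * ∏ j : Fin n, ((q ^ 2)⁻¹) ^ (j : ℕ) = q ^ n := by
  induction n with
  | zero => simp
  | succ n ih =>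
    have h : q ^ ((n + 1) * (n + 1)) = q ^ (n * n) * (q ^ 2) ^ n * q := by ring
    rw [Fin.prod_univ_castSucc, h, pow_succ q n, ← ih]
    simp only [Fin.val_castSucc, Fin.val_last, inv_pow]
    field_simp

lemma det_vandermonde_mul_comm {n : ℕ} (x y : Fin n → ℂ) :
    (Matrix.vandermonde (-x)).det * (Matrix.vandermonde y).det =
      (Matrix.vandermonde (-y)).det * (Matrix.vandermonde x).det := by
  have hneg (z : Fin n → ℂ) : -z = fun i => (-1) * z i := by
    ext i
    simp
  rw [hneg, hneg, det_vandermonde_smul, det_vandermonde_smul]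
  ring

lemma Kiz_eq_mul_Kiz_swap {q : ℂ} (hq : q ≠ 0) {n : ℕ} {x y : Fin n → ℂ}
    (hxy : ∀ i k, x i ≠ y k) (hyx : ∀ i k, (q ^ 2)⁻¹ * y i ≠ x k) :
    Kiz q x y = (-q) ^ (-(n : ℤ)) * (∏ k, ∏ i, fF q (x k) (y i)) *
      Kiz q (fun i => (q ^ 2)⁻¹ * y i) x := by
  have hdet : (∏ j, (q ^ 2 * ∏ i, (q * ((q ^ 2)⁻¹ * y j) - q⁻¹ * x i))) *
      (izerginMatrix q x y).det = (∏ i, ∏ j, (q * x i - q⁻¹ * y j)) *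
        (izerginMatrix q (fun i => (q ^ 2)⁻¹ * y i) x).det := by
    rw [← Matrix.det_transpose (izerginMatrix q _ x), ← Matrix.det_mul_row,
      ← Matrix.det_mul_column]
    congr 1
    ext i j
    have h1 : x i - y j ≠ 0 := sub_ne_zero.2 (hxy i j)
    have h2 : (q ^ 2)⁻¹ * y j - x i ≠ 0 := sub_ne_zero.2 (hyx j i)
    simp only [izerginMatrix, Matrix.of_apply, Matrix.transpose_apply]
    rw [← Finset.mul_prod_erase univ _ (mem_univ i), ← Finset.mul_prod_erase univ
      (fun k => q * x i - q⁻¹ * y k) (mem_univ j), div_mul_eq_mul_div, div_mul_eq_mul_div,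
      mul_div_assoc', mul_div_assoc', div_eq_div_iff h1 h2]
    generalize ∏ k ∈ univ.erase j, (q * x i - q⁻¹ * y k) = A
    generalize ∏ k ∈ univ.erase i, (q * ((q ^ 2)⁻¹ * y j) - q⁻¹ * x k) = B
    field_simp
    ring
  have hprod : ∏ j, (q ^ 2 * ∏ i, (q * ((q ^ 2)⁻¹ * y j) - q⁻¹ * x i)) =
      (q ^ 2) ^ n * ((-1) ^ n * (q ^ (n * n))⁻¹ * ∏ i, ∏ j, (x i - y j)) := by
    have hterm (i j : Fin n) :
        q * ((q ^ 2)⁻¹ * y j) - q⁻¹ * x i = -1 * q⁻¹ * (x i - y j) := by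
      field_simp
      ring
    have hsign : ((-1 : ℂ) ^ n) ^ n = (-1) ^ n := by
      rw [← pow_mul]
      rcases Nat.even_or_odd n with h | h
      · rw [h.neg_one_pow, (h.mul_right n).neg_one_pow]
      · rw [h.neg_one_pow, (h.mul h).neg_one_pow]
    simp only [hterm, Finset.prod_mul_distrib, Finset.prod_const, card_univ, Fintype.card_fin,
      hsign, pow_mul, inv_pow]
    rw [Finset.prod_comm]
  have hV : (Matrix.vandermonde (-fun i => (q ^ 2)⁻¹ * y i)).det =
      (∏ j : Fin n, ((q ^ 2)⁻¹) ^ (j : ℕ)) * (Matrix.vandermonde (-y)).det := by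
    rw [← det_vandermonde_smul]
    congr 2
    ext i
    simp
  have hT : ∏ j : Fin n, ((q ^ 2)⁻¹) ^ (j : ℕ) = q ^ n / q ^ (n * n) := by
    rw [eq_div_iff (by positivity), mul_comm, pow_mul_prod_inv_sq_pow hq]
  have hD : ∏ i, ∏ j, (x i - y j) ≠ 0 :=
    Finset.prod_ne_zero_iff.2 fun i _ => Finset.prod_ne_zero_iff.2 fun j _ =>
      sub_ne_zero.2 (hxy i j)
  have hs : ((-1 : ℂ) ^ n) * (-1) ^ n = 1 := by rw [← mul_pow]; simp
  have hs0 : ((-1 : ℂ) ^ n) ≠ 0 := by simp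
  have hqn : (-q) ^ (-(n : ℤ)) = (-1) ^ n / q ^ n := by
    rw [zpow_neg, zpow_natCast, neg_pow, mul_inv, ← eq_inv_of_mul_eq_one_left hs,
      div_eq_mul_inv]
  have hM : (izerginMatrix q x y).det = (∏ i, ∏ j, (q * x i - q⁻¹ * y j)) *
        (izerginMatrix q (fun i => (q ^ 2)⁻¹ * y i) x).det /
        ((q ^ 2) ^ n * ((-1) ^ n * (q ^ (n * n))⁻¹ * ∏ i, ∏ j, (x i - y j))) := by
    rw [eq_div_iff (by positivity), ← hdet, hprod]
    ring
  rw [Kiz_eq_det_s10, Kiz_eq_det_s10, hM, hV, hT, hqn,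
    mul_assoc (q ^ n / q ^ (n * n)), ← det_vandermonde_mul_comm x y]
  simp only [fF, Finset.prod_div_distrib]
  generalize (Matrix.vandermonde (-x)).det * (Matrix.vandermonde y).det = V
  rw [mul_inv (_ / _) V]
  have : (q ^ 2) ^ n = q ^ n * q ^ n := by ring
  rw [this]
  field_simp
  rw [pow_two ((-1 : ℂ) ^ n), hs, mul_one]

/-- The Izergin determinant whose left arguments are indexed by a finset. -/
noncomputable def KizLeft (q : ℂ) {N n : ℕ} (γ : Fin N → ℂ) (I : Finset (Fin N))
    (y : Fin n → ℂ) : ℂ :=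
  if h : I.card = n then Kiz q (sub γ I h) y else 0

/-- The Izergin determinant whose right arguments are indexed by a finset. -/
noncomputable def KizRight (q : ℂ) {N n : ℕ} (x : Fin n → ℂ) (γ : Fin N → ℂ)
    (I : Finset (Fin N)) : ℂ :=
  if h : I.card = n then Kiz q x (sub γ I h) else 0

lemma sub_injective {N n : ℕ} {γ : Fin N → ℂ} (hγ : Function.Injective γ) {S : Finset (Fin N)}
    (h : S.card = n) : Function.Injective (sub γ S h) :=
  hγ.comp (Subtype.val_injective.comp (S.orderIsoOfFin h).injective)

lemma sub_comp_succAbove {N n : ℕ} (γ : Fin N → ℂ) {S : Finset (Fin N)} (h : S.card = n + 1)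
    (k : Fin (n + 1)) (h' : (S.erase (S.orderEmbOfFin h k)).card = n) :
    sub γ S h ∘ k.succAbove = sub γ (S.erase (S.orderEmbOfFin h k)) h' := by
  have := Finset.orderEmbOfFin_unique h' (f := S.orderEmbOfFin h ∘ k.succAbove)
    (fun j => by simp [Fin.succAbove_ne])
    ((S.orderEmbOfFin h).strictMono.comp (Fin.strictMono_succAbove k))
  ext j
  exact congrArg γ (congrFun this j)

lemma prod_sub {N n : ℕ} (γ : Fin N → ℂ) {S : Finset (Fin N)} (h : S.card = n) (u : ℂ → ℂ) :
    ∏ i, u (sub γ S h i) = ∏ k ∈ S, u (γ k) := by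
  rw [← Finset.prod_coe_sort S, ← (S.orderIsoOfFin h).toEquiv.prod_comp]
  rfl

lemma sum_orderEmbOfFin {N n : ℕ} {S : Finset (Fin N)} (h : S.card = n) (u : Fin N → ℂ) :
    ∑ i, u (S.orderEmbOfFin h i) = ∑ k ∈ S, u k := by
  rw [← Finset.sum_coe_sort S, ← (S.orderIsoOfFin h).toEquiv.sum_comp]
  rfl

lemma KizRight_succAbove (q : ℂ) (hq : q - q⁻¹ ≠ 0) {N n : ℕ} {x : Fin (n + 1) → ℂ}
    {γ : Fin N → ℂ} (hx : Function.Injective x) (hγ : Function.Injective γ)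
    (hxγ : ∀ i k, x i ≠ γ k) {S : Finset (Fin N)} (hS : S.card = n + 1) (r : Fin (n + 1)) :
    KizRight q x γ S = ∑ k ∈ S, gF q (x r) (γ k) * (∏ j ∈ S.erase k, fF q (γ k) (γ j)) *
      (∏ i : Fin n, fF q (x (r.succAbove i)) (γ k)) *
      KizRight q (x ∘ r.succAbove) γ (S.erase k) := by
  rw [KizRight, dif_pos hS,
    Kiz_succAbove q hq hx (sub_injective hγ hS) (fun i k => hxγ i _) r,
    ← sum_orderEmbOfFin hS]
  refine Finset.sum_congr rfl fun k _ => ?_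
  have hk : (S.erase (S.orderEmbOfFin hS k)).card = n := by
    rw [Finset.card_erase_of_mem (S.orderEmbOfFin_mem hS k), hS, Nat.add_sub_cancel]
  rw [KizRight, dif_pos hk, ← sub_comp_succAbove γ hS k hk,
    ← prod_sub γ hk, ← sub_comp_succAbove γ hS k hk]
  rfl

lemma fF_mul_fF {q u v : ℂ} (hq : q ≠ 0) (huv : v ≠ u) (h : (q ^ 2)⁻¹ * v ≠ u) :
    fF q u v * fF q ((q ^ 2)⁻¹ * v) u = 1 := by
  have h1 : u - v ≠ 0 := sub_ne_zero.2 huv.symm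
  have h2 : (q ^ 2)⁻¹ * v - u ≠ 0 := sub_ne_zero.2 h
  rw [fF, fF, div_mul_div_comm, div_eq_one_iff_eq (mul_ne_zero h1 h2)]
  field_simp
  ring

lemma append_comp_succAbove_last {m n : ℕ} (x : Fin m → ℂ) (y : Fin (n + 1) → ℂ) :
    Fin.append x y ∘ (Fin.last (m + n)).succAbove =
      Fin.append x (y ∘ (Fin.last n).succAbove) := by
  ext i
  refine Fin.addCases (fun i => ?_) (fun i => ?_) i
  · rw [Function.comp_apply, Fin.append_left, Fin.succAbove_last]
    exact Fin.append_left x y i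
  · rw [Function.comp_apply, Fin.append_right, Fin.succAbove_last, Fin.succAbove_last]
    exact Fin.append_right x y i.castSucc

lemma append_last {m n : ℕ} (x : Fin m → ℂ) (y : Fin (n + 1) → ℂ) :
    Fin.append x y (Fin.last (m + n)) = y (Fin.last n) :=
  Fin.append_right x y (Fin.last n)

lemma append_injective {m n : ℕ} {x : Fin m → ℂ} {y : Fin n → ℂ} (hx : Function.Injective x)
    (hy : Function.Injective y) (hxy : ∀ i j, x i ≠ y j) :
    Function.Injective (Fin.append x y) :=
  Fin.append_injective_iff.2 ⟨hx, hy, hxy⟩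

lemma append_ne {m n : ℕ} {x : Fin m → ℂ} {y : Fin n → ℂ} {z : ℂ} (hx : ∀ i, x i ≠ z)
    (hy : ∀ j, y j ≠ z) (i : Fin (m + n)) : Fin.append x y i ≠ z := by
  refine Fin.addCases (fun i => ?_) (fun i => ?_) i
  · rw [Fin.append_left]
    exact hx i
  · rw [Fin.append_right]
    exact hy i

/-- The summation formula for the arguments `γ` restricted to a finset of indices. -/
lemma sum_KizLeft_mul_KizRight {q : ℂ} (hq : q ≠ 0) (hq' : q - q⁻¹ ≠ 0) {N m₁ : ℕ}
    {α : Fin m₁ → ℂ} {γ : Fin N → ℂ} (hα : Function.Injective α) (hγ : Function.Injective γ)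
    (hαγ : ∀ i k, α i ≠ γ k) (hαγ2 : ∀ i k, (q ^ 2)⁻¹ * α i ≠ γ k) (m₂ : ℕ)
    (β : Fin m₂ → ℂ) (hβ : Function.Injective β) (hβγ : ∀ j k, β j ≠ γ k)
    (hαβ : ∀ i j, (q ^ 2)⁻¹ * α i ≠ β j) (S : Finset (Fin N)) (hS : S.card = m₁ + m₂) :
    ∑ I ∈ powersetCard m₁ S, KizLeft q γ I α * KizRight q β γ (S \ I) *
        ∏ k ∈ S \ I, ∏ l ∈ I, fF q (γ k) (γ l) =
      (-q) ^ (-(m₁ : ℤ)) * (∏ k ∈ S, ∏ i, fF q (γ k) (α i)) *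
        KizRight q (Fin.append (fun i => (q ^ 2)⁻¹ * α i) β) γ S := by
  induction m₂ generalizing S with
  | zero =>
    have hS' : S.card = m₁ := hS
    have hβ0 : Fin.append (fun i => (q ^ 2)⁻¹ * α i) β = fun i => (q ^ 2)⁻¹ * α i := by
      ext i
      exact Fin.append_left (fun i => (q ^ 2)⁻¹ * α i) β i
    have hR : KizRight q (Fin.append (fun i => (q ^ 2)⁻¹ * α i) β) γ S =
        Kiz q (fun i => (q ^ 2)⁻¹ * α i) (sub γ S hS') := by
      rw [KizRight, dif_pos hS]
      exact congrArg (fun x : Fin m₁ → ℂ => Kiz q x (sub γ S hS')) hβ0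
    have hpow : powersetCard m₁ S = {S} := hS' ▸ powersetCard_self S
    rw [hpow, sum_singleton, Finset.sdiff_self, hR, KizLeft, KizRight, dif_pos hS',
      dif_pos card_empty,
      Kiz_eq_mul_Kiz_swap (x := sub γ S hS') hq (fun i k => (hαγ k _).symm) (fun i k => hαγ2 i _),
      prod_sub γ hS' fun z => ∏ i, fF q z (α i)]
    simp [Kiz]
  | succ m ih =>
    have hx : Function.Injective (Fin.append (fun i => (q ^ 2)⁻¹ * α i) β) :=
      append_injective (fun i j h => hα (mul_left_cancel₀ (inv_ne_zero (pow_ne_zero 2 hq)) h))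
        hβ hαβ
    have hexp := KizRight_succAbove q hq' (n := m₁ + m) hx hγ
      (fun i k => append_ne (fun i => hαγ2 i k) (fun j => hβγ j k) i) hS (Fin.last _)
    have hL (I : Finset (Fin N)) (hI : I ∈ powersetCard m₁ S) :
        KizLeft q γ I α * KizRight q β γ (S \ I) * ∏ k ∈ S \ I, ∏ l ∈ I, fF q (γ k) (γ l) =
        ∑ k ∈ S \ I, gF q (β (Fin.last m)) (γ k) * (∏ j ∈ S.erase k, fF q (γ k) (γ j)) *
          (∏ i : Fin m, fF q (β ((Fin.last m).succAbove i)) (γ k)) *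
          (KizLeft q γ I α * KizRight q (β ∘ (Fin.last m).succAbove) γ (S.erase k \ I) *
            ∏ k ∈ S.erase k \ I, ∏ l ∈ I, fF q (γ k) (γ l)) := by
      obtain ⟨hIS, hIc⟩ := mem_powersetCard.1 hI
      have hc : (S \ I).card = m + 1 := by
        rw [card_sdiff_of_subset hIS]
        omega
      rw [KizRight_succAbove q hq' hβ hγ hβγ hc (Fin.last m), mul_sum, sum_mul]
      refine sum_congr rfl fun k hk => ?_
      have hkI := (mem_sdiff.1 hk).2
      have e1 : (S \ I).erase k = S.erase k \ I := (erase_sdiff_comm S I k).symm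
      have e2 : ∏ j ∈ S.erase k, fF q (γ k) (γ j) =
          (∏ j ∈ S.erase k \ I, fF q (γ k) (γ j)) * ∏ j ∈ I, fF q (γ k) (γ j) :=
        (prod_sdiff (subset_erase.2 ⟨hIS, hkI⟩)).symm
      rw [← mul_prod_erase _ _ hk, e1, e2]
      ring
    rw [sum_congr rfl hL, sum_comm' (t' := S) (s' := fun k => powersetCard m₁ (S.erase k)),
      hexp, mul_sum]
    · refine sum_congr rfl fun k hk => ?_
      have hc : (S.erase k).card = m₁ + m := by
        rw [card_erase_of_mem hk]
        omega
      have hone : (∏ i, fF q (γ k) (α i)) * ∏ i, fF q ((q ^ 2)⁻¹ * α i) (γ k) = 1 := by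
        rw [← prod_mul_distrib]
        exact prod_eq_one fun i _ => fF_mul_fF hq (hαγ i k) (hαγ2 i k)
      have happ : ∏ i, fF q (Fin.append (fun i => (q ^ 2)⁻¹ * α i) β
          ((Fin.last (m₁ + m)).succAbove i)) (γ k) =
          (∏ i, fF q ((q ^ 2)⁻¹ * α i) (γ k)) *
            ∏ i, fF q (β ((Fin.last m).succAbove i)) (γ k) := by
        have := append_comp_succAbove_last (fun i => (q ^ 2)⁻¹ * α i) β
        simp only [funext_iff, Function.comp_apply] at this
        simp only [this, Fin.prod_univ_add, Fin.append_left, Fin.append_right,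
          Function.comp_apply]
      rw [← mul_sum, ih (β ∘ (Fin.last m).succAbove)
        (hβ.comp Fin.succAbove_right_injective) (fun j => hβγ _) (fun i j => hαβ i _) _ hc,
        append_comp_succAbove_last, append_last, happ, ← mul_prod_erase S _ hk]
      linear_combination (-(gF q (β (Fin.last m)) (γ k) *
        (∏ j ∈ S.erase k, fF q (γ k) (γ j)) *
          (∏ i : Fin m, fF q (β ((Fin.last m).succAbove i)) (γ k)) *
          ((-q) ^ (-(m₁ : ℤ)) * (∏ k ∈ S.erase k, ∏ i, fF q (γ k) (α i)) *
            KizRight q (Fin.append (fun i => (q ^ 2)⁻¹ * α i) (β ∘ (Fin.last m).succAbove)) γ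
              (S.erase k)))) * hone
    · intro I k
      simp only [mem_powersetCard, mem_sdiff, subset_erase]
      tauto

/-- Summation formula for the Izergin determinant (main lemma, first form). -/
theorem izergin_summation_first (q : ℂ) (hq : q ≠ 0) (hq2 : q ^ 2 ≠ 1)
    (m₁ m₂ : ℕ) (α : Fin m₁ → ℂ) (β : Fin m₂ → ℂ) (γ : Fin (m₁ + m₂) → ℂ)
    (hα : Function.Injective α) (hβ : Function.Injective β) (hγ : Function.Injective γ)
    (hαγ : ∀ i k, α i ≠ γ k) (hβγ : ∀ j k, β j ≠ γ k)
    (hαβ : ∀ i j, (q ^ 2)⁻¹ * α i ≠ β j)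
    (hαγ2 : ∀ i k, (q ^ 2)⁻¹ * α i ≠ γ k) :
    ∑ I ∈ (Finset.powersetCard m₁ (Finset.univ : Finset (Fin (m₁ + m₂)))).attach,
        Kiz q (sub γ I.1 (Finset.mem_powersetCard.mp I.2).2) α *
          Kiz q β (sub γ I.1ᶜ (card_compl_of_mem_powersetCard I)) *
          ∏ k ∈ I.1ᶜ, ∏ l ∈ I.1, fF q (γ k) (γ l)
      = (-q) ^ (-(m₁ : ℤ)) * (∏ k, ∏ i, fF q (γ k) (α i)) *
          Kiz q (Fin.append (fun i => (q ^ 2)⁻¹ * α i) β) γ := by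
  have hq' : q - q⁻¹ ≠ 0 := fun h => hq2 (by
    rw [pow_two, ← mul_inv_cancel₀ hq, ← sub_eq_zero.1 h])
  have hsub : sub γ univ (by simp) = γ := by
    have := orderEmbOfFin_unique (s := univ) (k := m₁ + m₂) (by simp) (f := id) (by simp)
      strictMono_id
    ext k
    exact congrArg γ (congrFun this k).symm
  have h := sum_KizLeft_mul_KizRight hq hq' hα hγ hαγ hαγ2 m₂ β hβ hβγ hαβ univ (by simp)
  rw [← sum_attach, KizRight, dif_pos (by simp), hsub] at h
  rw [← h]
  refine sum_congr rfl fun I _ => ?_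
  rw [← compl_eq_univ_sdiff, KizLeft, dif_pos (mem_powersetCard.mp I.2).2, KizRight,
    dif_pos (card_compl_of_mem_powersetCard I)]
end
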